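/- Every marked proper free-choice net having a home cluster is safe (1-bounded): every reachable marking has at most one token on each place. -/

import Mathlib

open scoped Classical

/-- A Petri net over places `P` and transitions `T`, given by preset and postset
of each transition (this encodes the flow relation `F`). -/
structure PetriNet (P T : Type) where
  pre : T → Finset P
  post : T → Finset P

namespace PetriNet

variable {P T : Type} [DecidableEq P] (N : PetriNet P T)

/-- A transition is enabled if each input place holds at least one token. -/
def enabled (M : P → ℕ) (t : T) : Prop := ∀ p ∈ N.pre t, 1 ≤ M p

/-- Firing a transition. -/
def fire (M : P → ℕ) (t : T) : P → ℕ :=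
  fun p => M p - (if p ∈ N.pre t then 1 else 0) + (if p ∈ N.post t then 1 else 0)

/-- `Fires M σ M'` : the firing sequence σ is enabled in M and leads to M'. -/
inductive Fires : (P → ℕ) → List T → (P → ℕ) → Prop
  | nil (M : P → ℕ) : Fires M [] M
  | cons {M : P → ℕ} {t : T} {σ : List T} {M'' : P → ℕ} :
      N.enabled M t → Fires (N.fire M t) σ M'' → Fires M (t :: σ) M''

/-- Reachability of markings. -/
def Reach (M M' : P → ℕ) : Prop := ∃ σ : List T, N.Fires M σ M'

/-- The set of transitions enabled in a marking. -/
def en (M : P → ℕ) : Set T := {t | N.enabled M t}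

/-- Lucency: reachable markings are determined by their sets of enabled transitions. -/
def Lucent (M : P → ℕ) : Prop :=
  ∀ M1 M2 : P → ℕ, N.Reach M M1 → N.Reach M M2 → N.en M1 = N.en M2 → M1 = M2

/-- Free-choice: presets of any two transitions are equal or disjoint. -/
def FreeChoice : Prop :=
  ∀ t1 t2 : T, N.pre t1 = N.pre t2 ∨ N.pre t1 ∩ N.pre t2 = ∅

/-- Proper: every transition has a nonempty preset and postset. -/
def Proper : Prop := ∀ t : T, (N.pre t).Nonempty ∧ (N.post t).Nonempty

/-- The directed edge (flow) relation on nodes `P ⊕ T`. -/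
def edge : (P ⊕ T) → (P ⊕ T) → Prop
  | Sum.inl p, Sum.inr t => p ∈ N.pre t
  | Sum.inr t, Sum.inl p => p ∈ N.post t
  | _, _ => False

/-- `InCluster x y` : y is in the cluster of x (smallest set containing x closed
under adding output transitions of places and input places of transitions). -/
inductive InCluster : (P ⊕ T) → (P ⊕ T) → Prop
  | refl (x : P ⊕ T) : InCluster x x
  | toTrans {x : P ⊕ T} {p : P} {t : T} :
      InCluster x (Sum.inl p) → p ∈ N.pre t → InCluster x (Sum.inr t)
  | toPlace {x : P ⊕ T} {t : T} {p : P} :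
      InCluster x (Sum.inr t) → p ∈ N.pre t → InCluster x (Sum.inl p)

/-- The cluster of a node. -/
def cluster (x : P ⊕ T) : Set (P ⊕ T) := {y | N.InCluster x y}

/-- A set of nodes is a cluster if it is the cluster of some node. -/
def IsCluster (C : Set (P ⊕ T)) : Prop := ∃ x : P ⊕ T, C = N.cluster x

/-- `Mrk(C)` : one token on each place of `C`, no tokens elsewhere. -/
noncomputable def clusterMrk (C : Set (P ⊕ T)) : P → ℕ :=
  fun p => if Sum.inl p ∈ C then 1 else 0

/-- A home marking is reachable from every reachable marking. -/
def IsHomeMarking (M MH : P → ℕ) : Prop := ∀ M', N.Reach M M' → N.Reach M' MH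

/-- A home cluster is a cluster whose marking `Mrk(C)` is a home marking. -/
def HomeCluster (M : P → ℕ) (C : Set (P ⊕ T)) : Prop :=
  N.IsCluster C ∧ N.IsHomeMarking M (clusterMrk C)

/-- A conflict-pair for `(N,M)`. -/
def ConflictPair (M M1 M2 : P → ℕ) : Prop :=
  N.Reach M M1 ∧ N.Reach M M2 ∧
  (∃ t, N.enabled M1 t) ∧ (∃ t, N.enabled M2 t) ∧
  (∀ t, ¬ (N.enabled M1 t ∧ N.enabled M2 t)) ∧
  (∀ t, N.enabled M1 t → ∃ p ∈ N.pre t, 1 ≤ M2 p) ∧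
  (∀ t, N.enabled M2 t → ∃ p ∈ N.pre t, 1 ≤ M1 p)

/-- A disentangled path `⟨p_1,t_1,p_2,…,t_{n-1},p_n⟩`, given by its lists of
places and transitions: consecutive nodes are connected by the flow relation and
all places lie in pairwise distinct clusters. -/
def IsDisPath (ps : List P) (ts : List T) : Prop :=
  ps.length = ts.length + 1 ∧
  (∀ (i : ℕ) (t : T) (p p' : P), ts[i]? = some t → ps[i]? = some p →
      ps[i + 1]? = some p' → p ∈ N.pre t ∧ p' ∈ N.post t) ∧
  ps.Pairwise (fun a b => N.cluster (Sum.inl a) ≠ N.cluster (Sum.inl b))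

/-- `Exp M σ σ'` : σ' is obtained from σ by repeatedly expediting transitions
(moving the transition at position j to an earlier position i, provided the
prefix of length i followed by that transition is enabled from M and no
transition at positions i..j-1 shares its cluster). -/
inductive Exp (M : P → ℕ) (σ : List T) : List T → Prop
  | refl : Exp M σ σ
  | step {σ' : List T} {i j : ℕ} (h : Exp M σ σ') (hij : i < j) (hj : j < σ'.length)
      (ha : ∃ Mx, N.Fires M (σ'.take i ++ [σ'.get ⟨j, hj⟩]) Mx)
      (hb : ∀ (k : ℕ) (hk : k < σ'.length), i ≤ k → k < j →
        N.cluster (Sum.inr (σ'.get ⟨k, hk⟩)) ≠ N.cluster (Sum.inr (σ'.get ⟨j, hj⟩))) :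
      Exp M σ ((σ'.eraseIdx j).insertIdx i (σ'.get ⟨j, hj⟩))

/-- Liveness: from every reachable marking, every transition can be enabled again. -/
def Live (M : P → ℕ) : Prop :=
  ∀ M', N.Reach M M' → ∀ t : T, ∃ M'', N.Reach M' M'' ∧ N.enabled M'' t

/-- Boundedness. -/
def Bounded (M : P → ℕ) : Prop :=
  ∃ k, ∀ M', N.Reach M M' → ∀ p, M' p ≤ k

/-- Safety (1-boundedness). -/
def Safe (M : P → ℕ) : Prop := ∀ M', N.Reach M M' → ∀ p, M' p ≤ 1

end PetriNet

namespace PetriNet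

section Aux

variable {P T : Type} [DecidableEq P] {N : PetriNet P T}

theorem fc_eq (hfc : N.FreeChoice) {t u : T} {p : P} (h1 : p ∈ N.pre t) (h2 : p ∈ N.pre u) :
    N.pre t = N.pre u := by
  rcases hfc t u with h | h
  · exact h
  · exfalso
    have : p ∈ N.pre t ∩ N.pre u := Finset.mem_inter.2 ⟨h1, h2⟩
    rw [h] at this
    simp at this

theorem fires_trans {X Y Z : P → ℕ} {σ τ : List T} (h : N.Fires X σ Y) (h' : N.Fires Y τ Z) :
    N.Fires X (σ ++ τ) Z := by
  induction h with
  | nil M => exact h'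
  | cons he _ ih => exact Fires.cons he (ih h')

theorem reach_trans {X Y Z : P → ℕ} (h : N.Reach X Y) (h' : N.Reach Y Z) : N.Reach X Z := by
  obtain ⟨σ, h⟩ := h
  obtain ⟨τ, h'⟩ := h'
  exact ⟨_, fires_trans h h'⟩

theorem reach_fire {X Y : P → ℕ} {t : T} (h : N.Reach X Y) (he : N.enabled Y t) :
    N.Reach X (N.fire Y t) :=
  reach_trans h ⟨[t], Fires.cons he (Fires.nil _)⟩

theorem fire_ge {X : P → ℕ} {t : T} {p : P} (h : p ∉ N.pre t) : X p ≤ N.fire X t p := by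
  simp [fire, h]

theorem fire_post {X : P → ℕ} {t : T} {p : P} (h : p ∈ N.post t) : 1 ≤ N.fire X t p := by
  simp [fire, h]

theorem enabled_fire {X : P → ℕ} {s u : T} (he : N.enabled X u)
    (hd : ∀ p ∈ N.pre u, p ∉ N.pre s) : N.enabled (N.fire X s) u := fun p hp =>
  (he p hp).trans (fire_ge (hd p hp))

theorem enabled_pre {X : P → ℕ} {s u : T} (he : N.enabled X u) (h : N.pre s = N.pre u) :
    N.enabled X s := by
  intro p hp
  rw [h] at hp
  exact he p hp

theorem fire_comm {X : P → ℕ} {s u : T} (hs : N.enabled X s) (hu : N.enabled X u)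
    (hd : ∀ p ∈ N.pre u, p ∉ N.pre s) :
    N.fire (N.fire X s) u = N.fire (N.fire X u) s := by
  funext p
  have h1 := hs p
  have h2 := hu p
  have h3 := hd p
  simp only [fire]
  split_ifs <;> grind

theorem pre_disj (hfc : N.FreeChoice) {s u : T} (h : N.pre s ≠ N.pre u) :
    ∀ p ∈ N.pre u, p ∉ N.pre s := fun _ hp hp' => h (fc_eq hfc hp' hp)

theorem expedite (hfc : N.FreeChoice) {Y Z : P → ℕ} {σ : List T} (h : N.Fires Y σ Z) (u : T)
    (hu : N.enabled Y u) (hex : ∃ s ∈ σ, N.pre s = N.pre u) :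
    ∃ t σ', N.pre t = N.pre u ∧ N.Fires (N.fire Y t) σ' Z ∧ σ'.length + 1 = σ.length := by
  induction h with
  | nil M => simp at hex
  | @cons Y s σ Z he hf ih =>
    by_cases hs : N.pre s = N.pre u
    · exact ⟨s, σ, hs, hf, rfl⟩
    · have hex' : ∃ s ∈ σ, N.pre s = N.pre u := by
        obtain ⟨r, hr, hr'⟩ := hex
        rcases List.mem_cons.1 hr with rfl | hr
        · exact absurd hr' hs
        · exact ⟨r, hr, hr'⟩
      obtain ⟨t, σ', ht, hf', hl⟩ := ih (enabled_fire hu (pre_disj hfc hs)) hex'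
      have hst : N.pre s ≠ N.pre t := by rw [ht]; exact hs
      refine ⟨t, s :: σ', ht, ?_, by simp; omega⟩
      have het := enabled_pre hu ht
      rw [fire_comm he het (pre_disj hfc hst)] at hf'
      exact Fires.cons (enabled_fire he (pre_disj hfc hst.symm)) hf'

theorem stays_enabled (hfc : N.FreeChoice) {Y Z : P → ℕ} {σ : List T} (h : N.Fires Y σ Z) (u : T)
    (hu : N.enabled Y u) (hex : ¬ ∃ s ∈ σ, N.pre s = N.pre u) : N.enabled Z u := by
  induction h with
  | nil M => exact hu
  | @cons Y s σ Z he hf ih =>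
    refine ih (enabled_fire hu (pre_disj hfc ?_)) ?_
    · exact fun h => hex ⟨s, by simp, h⟩
    · rintro ⟨r, hr, hr'⟩
      exact hex ⟨r, by simp [hr], hr'⟩

theorem cluster_pre (hfc : N.FreeChoice) {C : Set (P ⊕ T)} (hC : N.IsCluster C) {p : P} {t : T}
    (hp : Sum.inl p ∈ C) (ht : Sum.inr t ∈ C) : p ∈ N.pre t := by
  obtain ⟨x, rfl⟩ := hC
  rcases x with q | s
  · have key : ∀ y, N.InCluster (Sum.inl q) y →
        (∀ p, y = Sum.inl p → p = q ∨ ∃ s, q ∈ N.pre s ∧ p ∈ N.pre s) ∧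
        (∀ t, y = Sum.inr t → q ∈ N.pre t) := by
      intro y hy
      induction hy with
      | refl =>
        exact ⟨fun p h => Or.inl (Sum.inl.inj h).symm, fun t h => by cases h⟩
      | @toTrans p t h hp ih =>
        refine ⟨fun p h => (by cases h), fun t' h => ?_⟩
        cases h
        rcases ih.1 p rfl with h | ⟨s, h1, h2⟩
        · exact h ▸ hp
        · rw [← fc_eq hfc h2 hp]; exact h1
      | @toPlace t p h hp ih =>
        refine ⟨fun p' h => ?_, fun t' h => (by cases h)⟩
        cases h
        exact Or.inr ⟨t, ih.2 t rfl, hp⟩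
    have hq := (key _ ht).2 t rfl
    rcases (key _ hp).1 p rfl with h | ⟨s, h1, h2⟩
    · exact h ▸ hq
    · rw [← fc_eq hfc h1 hq]; exact h2
  · have key : ∀ y, N.InCluster (Sum.inr s) y →
        (∀ p, y = Sum.inl p → p ∈ N.pre s) ∧
        (∀ t, y = Sum.inr t → N.pre t = N.pre s) := by
      intro y hy
      induction hy with
      | refl =>
        exact ⟨fun p h => (by cases h), fun t h => (by cases h; rfl)⟩
      | @toTrans p t h hp ih =>
        refine ⟨fun p h => (by cases h), fun t' h => ?_⟩
        cases h
        exact fc_eq hfc hp (ih.1 p rfl)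
      | @toPlace t p h hp ih =>
        refine ⟨fun p' h => ?_, fun t' h => (by cases h)⟩
        cases h
        rw [← ih.2 t rfl]; exact hp
    rw [(key _ ht).2 t rfl]
    exact (key _ hp).1 p rfl

theorem cluster_trans {C : Set (P ⊕ T)} (hC : N.IsCluster C) {p : P} {t : T}
    (hp : Sum.inl p ∈ C) (ht : p ∈ N.pre t) : Sum.inr t ∈ C := by
  obtain ⟨x, rfl⟩ := hC
  exact InCluster.toTrans hp ht

theorem cluster_place {C : Set (P ⊕ T)} (hC : N.IsCluster C) {p : P} {t : T}
    (ht : Sum.inr t ∈ C) (hp : p ∈ N.pre t) : Sum.inl p ∈ C := by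
  obtain ⟨x, rfl⟩ := hC
  exact InCluster.toPlace ht hp

theorem mrk_in {C : Set (P ⊕ T)} {p : P} (h : Sum.inl p ∈ C) : clusterMrk C p = 1 := by
  simp [clusterMrk, h]

theorem mrk_out {C : Set (P ⊕ T)} {p : P} (h : Sum.inl p ∉ C) : clusterMrk C p = 0 := by
  simp [clusterMrk, h]

theorem mrk_le_of_enabled (hfc : N.FreeChoice) {C : Set (P ⊕ T)} (hC : N.IsCluster C)
    {X : P → ℕ} {u : T} (hu : Sum.inr u ∈ C) (he : N.enabled X u) (p : P) :
    clusterMrk C p ≤ X p := by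
  by_cases h : Sum.inl p ∈ C
  · rw [mrk_in h]; exact he p (cluster_pre hfc hC h hu)
  · rw [mrk_out h]; exact Nat.zero_le _

theorem mem_of_enabled_mrk (hp : N.Proper) {C : Set (P ⊕ T)} (hC : N.IsCluster C) {u : T}
    (he : N.enabled (clusterMrk C) u) : Sum.inr u ∈ C := by
  obtain ⟨p, hpu⟩ := (hp u).1
  have := he p hpu
  by_cases h : Sum.inl p ∈ C
  · exact cluster_trans hC h hpu
  · rw [mrk_out h] at this; omega

/-- A run that reaches the home marking without firing the home cluster, while the
home cluster is fully marked, is trivial. -/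
theorem no_fire (hp : N.Proper) {C : Set (P ⊕ T)} (hC : N.IsCluster C)
    {Y Z : P → ℕ} {σ : List T} (h : N.Fires Y σ Z) (hZ : Z = clusterMrk C)
    (hle : ∀ p, clusterMrk C p ≤ Y p) (hn : ∀ t ∈ σ, Sum.inr t ∉ C) : Y = clusterMrk C := by
  induction h with
  | nil M => exact hZ
  | @cons Y t σ Z he hf ih =>
    exfalso
    have ht : Sum.inr t ∉ C := hn t (by simp)
    have hle' : ∀ p, clusterMrk C p ≤ N.fire Y t p := by
      intro p
      by_cases h : Sum.inl p ∈ C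
      · exact (hle p).trans (fire_ge fun h' => ht (cluster_trans hC h h'))
      · rw [mrk_out h]; exact Nat.zero_le _
    have heq := ih hZ hle' (fun s hs => hn s (by simp [hs]))
    obtain ⟨p, hpt⟩ := (hp t).2
    have h1 := congrFun heq p
    by_cases h : Sum.inl p ∈ C
    · have h2 : p ∉ N.pre t := fun h' => ht (cluster_trans hC h h')
      have h3 := hle p
      rw [mrk_in h] at h1 h3
      simp [fire, h2, hpt] at h1
      omega
    · rw [mrk_out h] at h1
      simp [fire, hpt] at h1

/-- No reachable marking is strictly covered by a marking that can reach the home marking. -/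
theorem no_cover (hp : N.Proper) (hfc : N.FreeChoice) {M : P → ℕ} {C : Set (P ⊕ T)}
    (hc : N.HomeCluster M C) (n : ℕ) : ∀ (σ : List T) (X Y : P → ℕ), σ.length = n →
    N.Fires Y σ (clusterMrk C) → N.Reach M X → (∀ p, X p ≤ Y p) → X = Y := by
  obtain ⟨hC, hH⟩ := hc
  induction n with
  | zero =>
    intro σ X Y hl hf hX hle
    obtain rfl := List.length_eq_zero_iff.1 hl
    cases hf
    obtain ⟨τ, hτ⟩ := hH X hX
    cases hτ with
    | nil => rfl
    | @cons _ u _ _ he _ =>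
      have hu : Sum.inr u ∈ C := mem_of_enabled_mrk hp hC (fun p h => (he p h).trans (hle p))
      funext p
      exact le_antisymm (hle p) (mrk_le_of_enabled hfc hC hu he p)
  | succ n ihn =>
    intro σ X Y hl hf hX hle
    have main : ∀ u, N.enabled X u → X = Y := by
      intro u he
      have heY : N.enabled Y u := fun p h => (he p h).trans (hle p)
      by_cases hex : ∃ s ∈ σ, N.pre s = N.pre u
      · obtain ⟨t, σ', ht, hf', hl'⟩ := expedite hfc hf u heY hex
        have hXt := enabled_pre he ht
        have := ihn σ' (N.fire X t) (N.fire Y t) (by omega) hf' (reach_fire hX hXt) (by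
          intro p
          have := hle p
          simp only [fire]
          omega)
        funext p
        have h1 := congrFun this p
        have h2 := hXt p
        have h3 := hle p
        simp only [fire] at h1
        by_cases h : p ∈ N.pre t
        · have := h2 h
          simp only [h, if_true] at h1
          omega
        · simp only [h, if_false] at h1
          omega
      · have hu := mem_of_enabled_mrk hp hC (stays_enabled hfc hf u heY hex)
        have hXle := mrk_le_of_enabled hfc hC hu he
        have hY : Y = clusterMrk C := by
          refine no_fire hp hC hf rfl (fun p => (hXle p).trans (hle p)) ?_
          intro t ht htC
          obtain ⟨p, hpu⟩ := (hp u).1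
          exact hex ⟨t, ht, fc_eq hfc (cluster_pre hfc hC (cluster_place hC hu hpu) htC) hpu⟩
        funext p
        refine le_antisymm (hle p) ?_
        rw [hY]
        exact hXle p
    obtain ⟨τ, hτ⟩ := hH X hX
    cases hτ with
    | cons he _ => exact main _ he
    | nil =>
      by_cases hex : ∃ u, (Sum.inr u : P ⊕ T) ∈ C
      · obtain ⟨u, hu⟩ := hex
        exact main u (fun p h => (mrk_in (cluster_place hC hu h)).ge)
      · exact (no_fire hp hC hf rfl hle (fun t _ h => hex ⟨t, h⟩)).symm

/-- `Rk C n p`: there is a path with `n` transitions from `p` to the cluster `C`. -/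
def Rk (N : PetriNet P T) (C : Set (P ⊕ T)) : ℕ → P → Prop
  | 0, p => Sum.inl p ∈ C
  | n + 1, p => ∃ t, p ∈ N.pre t ∧ ∃ q ∈ N.post t, Rk N C n q

theorem exists_rk (hp : N.Proper) {C : Set (P ⊕ T)} {X Z : P → ℕ} {σ : List T}
    (h : N.Fires X σ Z) (hZ : Z = clusterMrk C) (p : P) (hm : 1 ≤ X p) : ∃ n, Rk N C n p := by
  induction h generalizing p with
  | nil M =>
    refine ⟨0, ?_⟩
    by_contra h
    rw [hZ, mrk_out h] at hm
    omega
  | @cons X t σ Z he hf ih =>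
    by_cases h : p ∈ N.pre t
    · obtain ⟨q, hq⟩ := (hp t).2
      obtain ⟨n, hn⟩ := ih hZ q (fire_post hq)
      exact ⟨n + 1, t, h, q, hq, hn⟩
    · exact ih hZ p (hm.trans (fire_ge h))

/-- The distance of `p` to `C` is `n`. -/
def DistTo (N : PetriNet P T) (C : Set (P ⊕ T)) (n : ℕ) (p : P) : Prop :=
  Rk N C n p ∧ ∀ m < n, ¬ Rk N C m p

theorem rk_same (hfc : N.FreeChoice) {C : Set (P ⊕ T)} (hC : N.IsCluster C) {p q : P} {t : T}
    (h1 : p ∈ N.pre t) (h2 : q ∈ N.pre t) {n : ℕ} (h : Rk N C n p) : Rk N C n q := by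
  cases n with
  | zero => exact cluster_place hC (cluster_trans hC h h1) h2
  | succ n =>
    obtain ⟨s, hs, r⟩ := h
    refine ⟨s, ?_, r⟩
    rw [fc_eq hfc hs h1]; exact h2

theorem exists_path {C : Set (P ⊕ T)} (n : ℕ) : ∀ p, DistTo N C n p →
    ∃ (f : ℕ → P), f n = p ∧ (∀ k ≤ n, DistTo N C k (f k)) ∧
      ∀ k < n, ∃ t, f (k + 1) ∈ N.pre t ∧ f k ∈ N.post t := by
  induction n with
  | zero =>
    intro p h
    refine ⟨fun _ => p, rfl, ?_, by omega⟩
    intro k hk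
    obtain rfl : k = 0 := by omega
    exact h
  | succ n ih =>
    rintro p ⟨⟨t, hpt, q, hq, hr⟩, hmin⟩
    obtain ⟨f, hfn, hd, hpath⟩ := ih q ⟨hr, fun m hm h => hmin (m + 1) (by omega)
      ⟨t, hpt, q, hq, h⟩⟩
    refine ⟨fun k => if k ≤ n then f k else p, by simp, ?_, ?_⟩
    · intro k hk
      by_cases h : k ≤ n
      · simp only [h, if_true]; exact hd k h
      · obtain rfl : k = n + 1 := by omega
        simp only [h, if_false]
        exact ⟨⟨t, hpt, q, hq, hr⟩, hmin⟩
    · intro k hk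
      by_cases h : k < n
      · have h1 : k + 1 ≤ n := h
        have h2 : k ≤ n := by omega
        simp only [h1, h2, if_true]
        exact hpath k h
      · obtain rfl : k = n := by omega
        refine ⟨t, ?_, ?_⟩
        · simpa using hpt
        · simpa [hfn] using hq

theorem two_tokens (hp : N.Proper) (hfc : N.FreeChoice) {M : P → ℕ} {C : Set (P ⊕ T)}
    (hc : N.HomeCluster M C) (hMM : N.Reach M (clusterMrk C)) (n : ℕ) (f : ℕ → P)
    (hd : ∀ k ≤ n, DistTo N C k (f k))
    (hpath : ∀ k < n, ∃ t, f (k + 1) ∈ N.pre t ∧ f k ∈ N.post t) (s : ℕ) :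
    ∀ i j, i ≤ n → j ≤ n → i + j = s → ∀ (σ : List T) (X : P → ℕ), N.Reach M X →
      N.Fires X σ (clusterMrk C) →
      (∀ r, (if r = f i then 1 else 0) + (if r = f j then 1 else 0) ≤ X r) → False := by
  have hC := hc.1
  have hnot : ∀ i j, i ≤ n → j ≤ n →
      ¬ (∀ r, (if r = f i then 1 else 0) + (if r = f j then 1 else 0) ≤ clusterMrk C r) := by
    intro i j hi hj h
    have h1 := h (f i)
    have h2 := h (f j)
    have h3 : ∀ k, 0 < k → k ≤ n → clusterMrk C (f k) = 0 :=
      fun k h0 hk => mrk_out ((hd k hk).2 0 h0)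
    have h4 : clusterMrk C (f i) ≤ 1 := by unfold clusterMrk; split_ifs <;> omega
    by_cases hij : i = j
    · subst hij
      simp at h1
      omega
    · rcases Nat.eq_zero_or_pos i with h0 | h0
      · have := h3 j (by omega) hj
        rw [this] at h2
        simp at h2
      · have := h3 i h0 hi
        rw [this] at h1
        simp at h1
  have hdist : ∀ i j, i ≤ n → j ≤ n → ∀ t, f i ∈ N.pre t → f j ∈ N.pre t → i = j := by
    intro i j hi hj t h1 h2
    rcases lt_trichotomy i j with h | h | h
    · exact absurd (rk_same hfc hC h1 h2 (hd i hi).1) ((hd j hj).2 i h)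
    · exact h
    · exact absurd (rk_same hfc hC h2 h1 (hd j hj).1) ((hd i hi).2 j h)
  induction s using Nat.strong_induction_on with
  | _ s ihs =>
  -- moving one token a step further along the path
  have step : ∀ i j, i ≤ n → j ≤ n → i + j = s → ∀ (X : P → ℕ), N.Reach M X →
      (∀ r, (if r = f i then 1 else 0) + (if r = f j then 1 else 0) ≤ X r) →
      ∀ t, Sum.inr t ∉ C → N.enabled X t → f i ∈ N.pre t → False := by
    intro i j hi hj hs X hX hle t htC het hit
    rcases i with _ | k
    · exact htC (cluster_trans hC (hd 0 hi).1 hit)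
    obtain ⟨u, hu1, hu2⟩ := hpath k (by omega)
    have heu : N.enabled X u := enabled_pre het (fc_eq hfc hu1 hit)
    have hX' := reach_fire hX heu
    obtain ⟨τ, hτ⟩ := hc.2 _ hX'
    refine ihs (k + j) (by omega) k j (by omega) hj rfl τ _ hX' hτ ?_
    intro r
    have h1 := hle r
    have h2 := heu r
    have h3 : r ∈ N.pre u → r = f j → r = f (k + 1) := by
      intro h h'
      subst h'
      rw [hdist (k + 1) j hi hj u hu1 h]
    have h4 : r = f k → r ∈ N.post u := fun h => h ▸ hu2
    simp only [fire]
    split_ifs at h1 ⊢ <;> grind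
  intro i j hi hj hs σ
  induction σ with
  | nil =>
    intro X hX hf hle
    cases hf
    exact hnot i j hi hj hle
  | cons t σ ih =>
    intro X hX hf hle
    have hf0 := hf
    cases hf with
    | cons he hf =>
    by_cases htC : Sum.inr t ∈ C
    · have := no_cover hp hfc hc _ _ _ _ rfl hf0 hMM (mrk_le_of_enabled hfc hC htC he)
      rw [← this] at hle
      exact hnot i j hi hj hle
    · by_cases h1 : f i ∈ N.pre t
      · exact step i j hi hj hs X hX hle t htC he h1
      by_cases h2 : f j ∈ N.pre t
      · exact step j i hj hi (by omega) X hX (fun r => by rw [add_comm]; exact hle r) t htC he h2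
      refine ih _ (reach_fire hX he) hf ?_
      intro r
      by_cases h : r ∈ N.pre t
      · have h3 : r ≠ f i := fun h' => h1 (h' ▸ h)
        have h4 : r ≠ f j := fun h' => h2 (h' ▸ h)
        simp [h3, h4]
      · exact (hle r).trans (fire_ge h)

end Aux

end PetriNet

/-- Marked proper free-choice nets having a home cluster are
safe (1-bounded). -/
theorem home_cluster_implies_safe {P T : Type} [DecidableEq P]
    (N : PetriNet P T) (M : P → ℕ) (C : Set (P ⊕ T))
    (hp : N.Proper) (hfc : N.FreeChoice) (hc : N.HomeCluster M C) :
    N.Safe M := by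
  intro X hX p
  by_contra hcon
  obtain ⟨σ, hσ⟩ := hc.2 X hX
  have hex := PetriNet.exists_rk hp hσ rfl p (by omega)
  classical
  obtain ⟨f, hfn, hd, hpath⟩ := PetriNet.exists_path (Nat.find hex) p
    ⟨Nat.find_spec hex, fun m hm => Nat.find_min hex hm⟩
  refine PetriNet.two_tokens hp hfc hc (hc.2 M ⟨[], PetriNet.Fires.nil _⟩) _ f hd hpath _ _ _
    le_rfl le_rfl rfl σ X hX hσ ?_
  intro r
  rw [hfn]
  split_ifs with h
  · subst h; omega
  · omega
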